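/- Let (x_i, x_i', y_i), i = 1,…,n, be labeled pairs with x_i, x_i' ∈ ℝ^p and y_i ∈ {-1,0,1}, and let I_y = {i : y_i = y}. Suppose u ∈ ℝ^p and β ∈ ℝ satisfy the constraints of the max-margin comparison QP, namely β + |uᵀ(x_i' − x_i)| ≤ −1 for every i ∈ I_0, and β + y_i·uᵀ(x_i' − x_i) ≥ 1 for every i ∈ I_1 ∪ I_{−1}. If I_0 is nonempty, then β ≤ −1, and the quantities μ̂ = −1/β and ŵ = −u/β satisfy μ̂ > 0, μ̂ ≤ 1 − |ŵᵀ(x_i' − x_i)| for every i ∈ I_0, and μ̂ ≤ −1 + y_i·ŵᵀ(x_i' − x_i) for every i ∈ I_1 ∪ I_{−1}; that is, (μ̂, ŵ) is feasible for the max-margin comparison LP. -/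

import Mathlib

open Matrix

/-- Lemma 1 (feasibility): if `(u, β)` satisfies the constraints of the max-margin
comparison QP and there is at least one equality pair, then `β ≤ -1` and
`μ̂ = -1/β`, `ŵ = -u/β` are feasible for the max-margin comparison LP. -/
theorem qp_feasible_implies_lp_feasible
    (n p : ℕ) (x x' : Fin n → Fin p → ℝ) (y : Fin n → ℝ)
    (hy : ∀ i, y i = -1 ∨ y i = 0 ∨ y i = 1)
    (u : Fin p → ℝ) (β : ℝ)
    (hQP0 : ∀ i, y i = 0 → β + |u ⬝ᵥ (x' i - x i)| ≤ -1)
    (hQP1 : ∀ i, y i = 1 ∨ y i = -1 → β + y i * (u ⬝ᵥ (x' i - x i)) ≥ 1)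
    (hI0 : ∃ i, y i = 0) :
    β ≤ -1 ∧
    (-1 / β > 0) ∧
    (∀ i, y i = 0 → -1 / β ≤ 1 - |((-β)⁻¹ • u) ⬝ᵥ (x' i - x i)|) ∧
    (∀ i, y i = 1 ∨ y i = -1 →
      -1 / β ≤ -1 + y i * (((-β)⁻¹ • u) ⬝ᵥ (x' i - x i))) := by
  have hβ : β ≤ -1 := by
    obtain ⟨i, hi⟩ := hI0
    linarith [hQP0 i hi, abs_nonneg (u ⬝ᵥ (x' i - x i))]
  have hpos : 0 < (-β)⁻¹ := inv_pos.mpr (by linarith)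
  have hcancel : (-β)⁻¹ * -β = 1 := inv_mul_cancel₀ (by linarith)
  have hdiv : -1 / β = (-β)⁻¹ := by rw [inv_neg, neg_div, one_div]
  refine ⟨hβ, hdiv ▸ hpos, fun i hi => ?_, fun i hi => ?_⟩
  · rw [hdiv, smul_dotProduct, smul_eq_mul, abs_mul, abs_of_pos hpos]
    linarith [mul_le_mul_of_nonneg_left (hQP0 i hi) hpos.le]
  · rw [hdiv, smul_dotProduct, smul_eq_mul]
    linarith [mul_le_mul_of_nonneg_left (hQP1 i hi) hpos.le]
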